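/- arXiv:1011.2142 — 2 statements merged into one kernel-verified Lean document; each statement's English description precedes it below -/
import Mathlib

section
/- Let f : ℝ^d → ℝ be continuous and bounded from below. Then (∫ e^{−f} dγ_d) · (∫ e^{f ⊡ (c/4)} dγ_d) ≤ 1, where c(x) = |x|², i.e. the Gaussian measure γ_d together with the weight |x|²/4 satisfies Talagrand's property (τ). -/
open MeasureTheory Real

/-- The standard Gaussian probability measure on `ℝ^d`. -/
noncomputable def stdGauss (d : ℕ) : Measure (EuclideanSpace ℝ (Fin d)) :=
  volume.withDensity fun x =>
    ENNReal.ofReal ((2 * π) ^ (-(d : ℝ) / 2) * Real.exp (-‖x‖ ^ 2 / 2))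

/-- The infimum convolution with the quarter-quadratic cost:
`(f ⊡ c/4)(x) = inf_y ( f(x+y) + |y|²/4 )`. -/
noncomputable def infConvQuarter {E : Type*} [NormedAddCommGroup E]
    (f : E → ℝ) (x : E) : ℝ :=
  ⨅ y : E, (f (x + y) + ‖y‖ ^ 2 / 4)

open Set
open scoped ENNReal NNReal

/-- The one-dimensional Brunn–Minkowski inequality for midpoints. -/
theorem volume_add_volume_le_of_midpoint_mem {A B S : Set ℝ} (hA : MeasurableSet A)
    (hB : MeasurableSet B) (hA₀ : A.Nonempty) (hB₀ : B.Nonempty)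
    (hS : ∀ x ∈ A, ∀ y ∈ B, (1 / 2 : ℝ) * (x + y) ∈ S) :
    volume A + volume B ≤ 2 * volume S := by
  have hvol : volume ((fun z : ℝ => (1 / 2 : ℝ) * z) ⁻¹' S) = 2 * volume S := by
    rw [Real.volume_preimage_mul_left (by norm_num)]
    norm_num
  rw [← hvol]
  set T := (fun z : ℝ => (1 / 2 : ℝ) * z) ⁻¹' S
  have hcompact : ∀ K L : Set ℝ, K ⊆ A → L ⊆ B → IsCompact K → IsCompact L →
      K.Nonempty → L.Nonempty → volume K + volume L ≤ volume T := by
    intro K L hKA hLB hK hL hK₀ hL₀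
    obtain ⟨k, hk, hkmax⟩ := hK.exists_isGreatest hK₀
    obtain ⟨l, hl, hlmin⟩ := hL.exists_isLeast hL₀
    have hdisj : AEDisjoint volume ((fun z => l + z) '' K) ((fun z => k + z) '' L) := by
      refine measure_mono_null (t := {k + l}) ?_ (by simp)
      rintro _ ⟨⟨x, hx, rfl⟩, y, hy, hxy⟩
      have h₁ := hkmax hx
      have h₂ := hlmin hy
      simp only at hxy
      simp only [mem_singleton_iff]
      linarith
    calc volume K + volume L
        = volume ((fun z => l + z) '' K) + volume ((fun z => k + z) '' L) := by
          simp only [image_add_left, measure_preimage_add]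
      _ = volume ((fun z => l + z) '' K ∪ (fun z => k + z) '' L) := by
          refine (measure_union₀ ?_ hdisj).symm
          exact (hL.image (by fun_prop)).measurableSet.nullMeasurableSet
      _ ≤ volume T := by
          refine measure_mono (union_subset ?_ ?_)
          · rintro _ ⟨x, hx, rfl⟩
            have := hS x (hKA hx) l (hLB hl)
            rwa [add_comm] at this
          · rintro _ ⟨y, hy, rfl⟩
            exact hS k (hKA hk) y (hLB hy)
  obtain ⟨a, ha⟩ := hA₀
  obtain ⟨b, hb⟩ := hB₀
  rw [hA.measure_eq_iSup_isCompact, hB.measure_eq_iSup_isCompact]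
  simp only [iSup_and']
  refine ENNReal.biSup_add_biSup_le' ⟨∅, empty_subset _, isCompact_empty⟩
    ⟨∅, empty_subset _, isCompact_empty⟩ fun K hK L hL => ?_
  refine (add_le_add (measure_mono (subset_insert a K)) (measure_mono (subset_insert b L))).trans ?_
  exact hcompact _ _ (insert_subset ha hK.1) (insert_subset hb hL.1) (hK.2.insert a)
    (hL.2.insert b) (insert_nonempty _ _) (insert_nonempty _ _)

/-- A linear form of the one-dimensional Prékopa–Leindler inequality, for functions with
supremum one. -/
theorem lintegral_add_lintegral_le_of_sup_eq_one {u v h : ℝ → ℝ} (hu : Measurable u)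
    (hv : Measurable v) (hh : Measurable h) (hu₀ : 0 ≤ u) (hv₀ : 0 ≤ v) (hh₀ : 0 ≤ h)
    (hu₁ : ∀ x, u x ≤ 1) (hv₁ : ∀ x, v x ≤ 1) (hu_sup : ∀ t < 1, ∃ x, t < u x)
    (hv_sup : ∀ t < 1, ∃ x, t < v x)
    (huvh : ∀ x y, u x * v y ≤ h ((1 / 2 : ℝ) * (x + y)) ^ 2) :
    (∫⁻ x, ENNReal.ofReal (u x)) + ∫⁻ x, ENNReal.ofReal (v x)
      ≤ 2 * ∫⁻ x, ENNReal.ofReal (h x) := by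
  have hmeas : ∀ w : ℝ → ℝ, Measurable fun t : ℝ => volume {a | t < w a} := fun w =>
    Antitone.measurable fun s t hst => measure_mono fun x hx => lt_of_le_of_lt hst hx
  rw [lintegral_eq_lintegral_meas_lt _ (ae_of_all _ hu₀) hu.aemeasurable,
    lintegral_eq_lintegral_meas_lt _ (ae_of_all _ hv₀) hv.aemeasurable,
    lintegral_eq_lintegral_meas_lt _ (ae_of_all _ hh₀) hh.aemeasurable,
    ← lintegral_add_left (hmeas u), ← lintegral_const_mul _ (hmeas h)]
  refine setLIntegral_mono' measurableSet_Ioi fun t ht => ?_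
  have ht₀ : 0 < t := ht
  rcases lt_or_ge t 1 with ht₁ | ht₁
  · refine volume_add_volume_le_of_midpoint_mem (measurableSet_lt measurable_const hu)
      (measurableSet_lt measurable_const hv) (hu_sup t ht₁) (hv_sup t ht₁) fun x hx y hy => ?_
    have hx' : t < u x := hx
    have hy' : t < v y := hy
    refine lt_of_pow_lt_pow_left₀ 2 (hh₀ _) (lt_of_lt_of_le ?_ (huvh x y))
    nlinarith
  · have hempty : ∀ w : ℝ → ℝ, (∀ x, w x ≤ 1) → {a | t < w a} = ∅ := fun w hw =>
      eq_empty_of_forall_notMem fun x hx => absurd (hw x) (not_le.2 (lt_of_le_of_lt ht₁ hx))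
    simp [hempty u hu₁, hempty v hv₁]

theorem ENNReal.mul_le_sq_of_add_le_two_mul {a b c : ℝ≥0∞} (h : a + b ≤ 2 * c) :
    a * b ≤ c ^ 2 := by
  rcases eq_or_ne c ∞ with rfl | hc
  · simp
  have hab : a + b ≠ ∞ := ne_top_of_le_ne_top (ENNReal.mul_ne_top (by simp) hc) h
  rw [ENNReal.add_ne_top] at hab
  lift a to ℝ≥0 using hab.1
  lift b to ℝ≥0 using hab.2
  lift c to ℝ≥0 using hc
  norm_cast at h ⊢
  rw [← NNReal.coe_le_coe] at h ⊢
  push_cast at h ⊢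
  nlinarith [sq_nonneg ((a : ℝ) - b), a.coe_nonneg, b.coe_nonneg, c.coe_nonneg]

/-- The one-dimensional Prékopa–Leindler inequality for bounded real functions. -/
theorem prekopa_leindler_real_of_bounded {u v h : ℝ → ℝ} (hu : Measurable u)
    (hv : Measurable v) (hh : Measurable h) (hu₀ : 0 ≤ u) (hv₀ : 0 ≤ v) (hh₀ : 0 ≤ h)
    (hu_bdd : BddAbove (range u)) (hv_bdd : BddAbove (range v))
    (huvh : ∀ x y, u x * v y ≤ h ((1 / 2 : ℝ) * (x + y)) ^ 2) :
    (∫⁻ x, ENNReal.ofReal (u x)) * ∫⁻ x, ENNReal.ofReal (v x)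
      ≤ (∫⁻ x, ENNReal.ofReal (h x)) ^ 2 := by
  set a := ⨆ x, u x with ha
  set b := ⨆ x, v x with hb
  have hua : ∀ x, u x ≤ a := le_ciSup hu_bdd
  have hvb : ∀ x, v x ≤ b := le_ciSup hv_bdd
  rcases ((hu₀ 0).trans (hua 0)).eq_or_lt with ha₀ | ha₀
  · have : ∀ x, ENNReal.ofReal (u x) = 0 := fun x =>
      ENNReal.ofReal_of_nonpos ((hua x).trans ha₀.symm.le)
    simp [this]
  rcases ((hv₀ 0).trans (hvb 0)).eq_or_lt with hb₀ | hb₀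
  · have : ∀ x, ENNReal.ofReal (v x) = 0 := fun x =>
      ENNReal.ofReal_of_nonpos ((hvb x).trans hb₀.symm.le)
    simp [this]
  simp only [Pi.zero_apply] at ha₀ hb₀
  have hscale : ∀ (w : ℝ → ℝ) (c : ℝ), Measurable w → 0 < c →
      ∫⁻ x, ENNReal.ofReal (w x) = ENNReal.ofReal c * ∫⁻ x, ENNReal.ofReal (w x / c) := by
    intro w c hw hc
    rw [← lintegral_const_mul _ (by fun_prop)]
    refine lintegral_congr fun x => ?_
    rw [← ENNReal.ofReal_mul hc.le, mul_div_cancel₀ _ hc.ne']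
  have hab : 0 < √(a * b) := Real.sqrt_pos.2 (mul_pos ha₀ hb₀)
  have hsup : ∀ (w : ℝ → ℝ) (c : ℝ), 0 < c → c = ⨆ x, w x → ∀ t < 1, ∃ x, t < w x / c := by
    intro w c hc hcw t ht
    obtain ⟨x, hx⟩ := exists_lt_of_lt_ciSup (show t * c < ⨆ x, w x by rw [← hcw]; nlinarith)
    exact ⟨x, (lt_div_iff₀ hc).2 hx⟩
  have key := lintegral_add_lintegral_le_of_sup_eq_one (hu.div_const a) (hv.div_const b)
    (hh.div_const √(a * b)) (fun x => div_nonneg (hu₀ x) ha₀.le)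
    (fun x => div_nonneg (hv₀ x) hb₀.le) (fun x => div_nonneg (hh₀ x) hab.le)
    (fun x => (div_le_one ha₀).2 (hua x)) (fun x => (div_le_one hb₀).2 (hvb x))
    (hsup u a ha₀ ha) (hsup v b hb₀ hb) fun x y => by
      rw [div_pow, Real.sq_sqrt (mul_pos ha₀ hb₀).le, div_mul_div_comm]
      exact div_le_div_of_nonneg_right (huvh x y) (mul_pos ha₀ hb₀).le
  rw [hscale u a hu ha₀, hscale v b hv hb₀, hscale h _ hh hab, mul_mul_mul_comm, mul_pow,
    ← ENNReal.ofReal_mul ha₀.le, ← ENNReal.ofReal_pow hab.le, Real.sq_sqrt (mul_pos ha₀ hb₀).le]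
  gcongr
  exact ENNReal.mul_le_sq_of_add_le_two_mul key

/-- A measure on a real vector space satisfies the midpoint Prékopa–Leindler inequality. -/
def SatisfiesPrekopaLeindler {E : Type*} [AddCommGroup E] [Module ℝ E] [MeasurableSpace E]
    (μ : Measure E) : Prop :=
  ∀ u v h : E → ℝ≥0∞, Measurable u → Measurable v → Measurable h →
    (∀ x y, u x * v y ≤ h ((1 / 2 : ℝ) • (x + y)) ^ 2) →
    (∫⁻ x, u x ∂μ) * ∫⁻ x, v x ∂μ ≤ (∫⁻ x, h x ∂μ) ^ 2

theorem lintegral_eq_iSup_lintegral_min_natCast {α : Type*} [MeasurableSpace α] (μ : Measure α)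
    {w : α → ℝ≥0∞} (hw : Measurable w) :
    ∫⁻ x, w x ∂μ = ⨆ n : ℕ, ∫⁻ x, min (w x) n ∂μ := by
  rw [← lintegral_iSup (fun n => hw.min measurable_const)
    fun m n hmn x => min_le_min_left _ (by exact_mod_cast hmn)]
  refine lintegral_congr fun x => ?_
  rw [← inf_iSup_eq, ENNReal.iSup_natCast, inf_top_eq]

theorem satisfiesPrekopaLeindler_real : SatisfiesPrekopaLeindler (volume : Measure ℝ) := by
  intro u v h hu hv hh huvh
  have hmono : ∀ w : ℝ → ℝ≥0∞, Monotone fun n : ℕ => ∫⁻ x, min (w x) n := fun w m n hmn =>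
    lintegral_mono fun x => min_le_min_left _ (by exact_mod_cast hmn)
  rw [lintegral_eq_iSup_lintegral_min_natCast _ hu, lintegral_eq_iSup_lintegral_min_natCast _ hv]
  simp_rw [ENNReal.iSup_mul, ENNReal.mul_iSup]
  refine iSup₂_le fun k m => ?_
  refine (mul_le_mul' (hmono u (le_max_left k m)) (hmono v (le_max_right k m))).trans ?_
  generalize max k m = n
  have hfin : ∀ (w : ℝ → ℝ≥0∞) x, min (w x) n ≠ ∞ := fun w x =>
    ne_top_of_le_ne_top (ENNReal.natCast_ne_top n) (min_le_right _ _)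
  have hbdd : ∀ w : ℝ → ℝ≥0∞, BddAbove (range fun x => (min (w x) n).toReal) := by
    rintro w
    refine ⟨n, ?_⟩
    rintro _ ⟨x, rfl⟩
    exact ENNReal.toReal_le_of_le_ofReal n.cast_nonneg (by simp)
  have key := prekopa_leindler_real_of_bounded
    (hu.min (measurable_const (a := (n : ℝ≥0∞)))).ennreal_toReal
    (hv.min (measurable_const (a := (n : ℝ≥0∞)))).ennreal_toReal
    (hh.min (measurable_const (a := (n : ℝ≥0∞)))).ennreal_toReal
    (fun x => ENNReal.toReal_nonneg) (fun x => ENNReal.toReal_nonneg)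
    (fun x => ENNReal.toReal_nonneg) (hbdd u) (hbdd v) fun x y => by
      rw [← ENNReal.toReal_mul, ← ENNReal.toReal_pow]
      refine ENNReal.toReal_mono (ENNReal.pow_ne_top (hfin h _)) ?_
      rcases le_total (h ((1 / 2 : ℝ) * (x + y))) n with hn | hn
      · rw [min_eq_left hn]
        exact (mul_le_mul' (min_le_left _ _) (min_le_left _ _)).trans (huvh x y)
      · rw [min_eq_right hn, sq]
        exact mul_le_mul' (min_le_right _ _) (min_le_right _ _)
  simp only [ENNReal.ofReal_toReal (hfin _ _)] at key
  refine key.trans ?_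
  gcongr
  exact min_le_left _ _

theorem SatisfiesPrekopaLeindler.prod {E F : Type*} [AddCommGroup E] [Module ℝ E]
    [MeasurableSpace E] [AddCommGroup F] [Module ℝ F] [MeasurableSpace F] {μ : Measure E}
    {ν : Measure F} [SFinite ν] (hμ : SatisfiesPrekopaLeindler μ)
    (hν : SatisfiesPrekopaLeindler ν) : SatisfiesPrekopaLeindler (μ.prod ν) := by
  intro u v h hu hv hh huvh
  rw [lintegral_prod _ hu.aemeasurable, lintegral_prod _ hv.aemeasurable,
    lintegral_prod _ hh.aemeasurable]
  refine hμ _ _ _ hu.lintegral_prod_right' hv.lintegral_prod_right' hh.lintegral_prod_right'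
    fun x y => ?_
  exact hν _ _ _ (by fun_prop) (by fun_prop) (by fun_prop) fun z w => huvh (x, z) (y, w)

theorem SatisfiesPrekopaLeindler.of_measurePreserving {E F : Type*} [AddCommGroup E]
    [Module ℝ E] [MeasurableSpace E] [AddCommGroup F] [Module ℝ F] [MeasurableSpace F]
    {μ : Measure E} {ν : Measure F} (hμ : SatisfiesPrekopaLeindler μ) (e : E →ₗ[ℝ] F)
    (he : MeasurePreserving e μ ν) : SatisfiesPrekopaLeindler ν := by
  intro u v h hu hv hh huvh
  rw [← he.lintegral_comp hu, ← he.lintegral_comp hv, ← he.lintegral_comp hh]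
  refine hμ _ _ _ (hu.comp he.measurable) (hv.comp he.measurable) (hh.comp he.measurable)
    fun x y => ?_
  rw [map_smul, map_add]
  exact huvh _ _

theorem satisfiesPrekopaLeindler_pi (n : ℕ) :
    SatisfiesPrekopaLeindler (volume : Measure (Fin n → ℝ)) := by
  induction n with
  | zero =>
    intro u v h hu hv hh huvh
    have hvol : (volume : Measure (Fin 0 → ℝ)) = Measure.dirac 0 := by
      rw [volume_pi, Measure.pi_of_empty _ 0]
    rw [hvol, lintegral_dirac' _ hu, lintegral_dirac' _ hv, lintegral_dirac' _ hh]
    simpa using huvh 0 0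
  | succ n ih =>
    exact (satisfiesPrekopaLeindler_real.prod ih).of_measurePreserving
      (Fin.consLinearEquiv ℝ (fun _ : Fin (n + 1) => ℝ)).toLinearMap
      (by
        convert! (volume_preserving_piFinSuccAbove (fun _ : Fin (n + 1) => ℝ) 0).symm using 1
        ext x i
        simp [Fin.insertNthEquiv])

theorem satisfiesPrekopaLeindler_euclideanSpace (n : ℕ) :
    SatisfiesPrekopaLeindler (volume : Measure (EuclideanSpace ℝ (Fin n))) :=
  (satisfiesPrekopaLeindler_pi n).of_measurePreserving
    (WithLp.linearEquiv 2 ℝ (Fin n → ℝ)).symm.toLinearMap (PiLp.volume_preserving_toLp (Fin n))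

theorem lintegral_gaussian_density (d : ℕ) :
    ∫⁻ x : EuclideanSpace ℝ (Fin d),
      ENNReal.ofReal ((2 * π) ^ (-(d : ℝ) / 2) * Real.exp (-‖x‖ ^ 2 / 2)) = 1 := by
  have hI : ∫ x : EuclideanSpace ℝ (Fin d), Real.exp (-‖x‖ ^ 2 / 2)
      = (2 * π) ^ ((d : ℝ) / 2) := by
    have := GaussianFourier.integral_rexp_neg_mul_sq_norm
      (V := EuclideanSpace ℝ (Fin d)) (b := 1 / 2) (by norm_num)
    rw [finrank_euclideanSpace_fin] at this
    convert this using 3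
    · ring_nf
    · ring
  have hpos : (0 : ℝ) < (2 * π) ^ ((d : ℝ) / 2) := Real.rpow_pos_of_pos (by positivity) _
  rw [← ofReal_integral_eq_lintegral_ofReal, integral_const_mul, hI,
    ← Real.rpow_add (by positivity)]
  · simp [neg_div]
  · refine Integrable.const_mul ?_ _
    by_contra hcon
    rw [integral_undef hcon] at hI
    exact hpos.ne hI
  · exact ae_of_all _ fun x => by positivity

theorem bddBelow_range_add_norm_sq {E : Type*} [NormedAddCommGroup E] {f : E → ℝ}
    (hf : BddBelow (range f)) (x : E) :
    BddBelow (range fun y => f (x + y) + ‖y‖ ^ 2 / 4) := by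
  obtain ⟨m, hm⟩ := hf
  refine ⟨m, ?_⟩
  rintro _ ⟨y, rfl⟩
  exact le_add_of_le_of_nonneg (hm ⟨x + y, rfl⟩) (by positivity)

theorem measurable_infConvQuarter {E : Type*} [NormedAddCommGroup E] [MeasurableSpace E]
    [OpensMeasurableSpace E] {f : E → ℝ} (hf : Continuous f) (hf_bdd : BddBelow (range f)) :
    Measurable (infConvQuarter f) :=
  (upperSemicontinuous_ciInf (bddBelow_range_add_norm_sq hf_bdd) fun y =>
    Continuous.upperSemicontinuous (by fun_prop)).measurable

/-- Talagrand's property (τ) for the Gaussian measure with cost `|x|²/4`: for any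
continuous `f` bounded from below, `(∫ e^{-f} dγ_d) (∫ e^{f ⊡ c/4} dγ_d) ≤ 1`. -/
theorem tau_gaussian_quarter (d : ℕ) (f : EuclideanSpace ℝ (Fin d) → ℝ)
    (hf_cont : Continuous f) (hf_bdd : BddBelow (Set.range f)) :
    (∫⁻ x, ENNReal.ofReal (Real.exp (-f x)) ∂stdGauss d) *
      (∫⁻ x, ENNReal.ofReal (Real.exp (infConvQuarter f x)) ∂stdGauss d) ≤ 1 := by
  have hQ := measurable_infConvQuarter hf_cont hf_bdd
  have hf := hf_cont.measurable
  unfold stdGauss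
  rw [lintegral_withDensity_eq_lintegral_mul _ (by fun_prop) (by fun_prop),
    lintegral_withDensity_eq_lintegral_mul _ (by fun_prop) (by fun_prop),
    ← one_pow 2, ← lintegral_gaussian_density d]
  refine satisfiesPrekopaLeindler_euclideanSpace d _ _ _ (by fun_prop) (by fun_prop)
    (by fun_prop) fun x y => ?_
  have hxy : infConvQuarter f y ≤ f x + ‖x - y‖ ^ 2 / 4 := by
    simpa [infConvQuarter] using ciInf_le (bddBelow_range_add_norm_sq hf_bdd y) (x - y)
  have hpar := parallelogram_law_with_norm ℝ x y
  have hnorm : ‖(1 / 2 : ℝ) • (x + y)‖ ^ 2 = ‖x + y‖ ^ 2 / 4 := by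
    rw [norm_smul, mul_pow]
    norm_num
    ring
  simp only [Pi.mul_apply]
  rw [← ENNReal.ofReal_mul (by positivity), ← ENNReal.ofReal_mul (by positivity),
    ← ENNReal.ofReal_mul (by positivity), ← ENNReal.ofReal_pow (by positivity)]
  refine ENNReal.ofReal_le_ofReal ?_
  rw [mul_pow, ← Real.exp_nat_mul, hnorm, mul_assoc _ _ (Real.exp (-f x)),
    mul_assoc _ _ (Real.exp (infConvQuarter f y)),
    mul_mul_mul_comm, ← Real.exp_add, ← Real.exp_add, ← Real.exp_add, ← sq]
  refine mul_le_mul_of_nonneg_left (Real.exp_le_exp.2 ?_) (by positivity)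
  push_cast
  nlinarith
end

section
/- For every C > 0 there is a constant K₆ depending only on C such that: for every ε ∈ (0,1] and every C² function f ∈ F(C,ε) with E f(X) = 0 (X a standard Gaussian vector on ℝ^d), one has E[e^{Hf(X)}] ≤ 1 + ½ E[f(X)²] − ½ E[|∇f(X)|²] + K₆ ε³. -/
open MeasureTheory Real

/-- The quadratic infimum convolution `Hf(x) = inf_y ( f(x+y) + |y|²/2 )`. -/
noncomputable def Hconv {E : Type*} [NormedAddCommGroup E] (f : E → ℝ) (x : E) : ℝ :=
  ⨅ y : E, (f (x + y) + ‖y‖ ^ 2 / 2)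

/-- The class `F(C,ε)`: functions that are `Cε`-Lipschitz and satisfy
`f(x+h) + f(x-h) - 2f(x) ≤ Cε²|h|²` for all `x, h`. -/
def memF {E : Type*} [NormedAddCommGroup E] (C ε : ℝ) (f : E → ℝ) : Prop :=
  LipschitzWith (C * ε).toNNReal f ∧
    ∀ x h : E, f (x + h) + f (x - h) - 2 * f x ≤ C * ε ^ 2 * ‖h‖ ^ 2

open ProbabilityTheory
open scoped RealInnerProductSpace

theorem integral_stdGauss {F : Type*} [NormedAddCommGroup F] [NormedSpace ℝ F] (d : ℕ)
    (g : EuclideanSpace ℝ (Fin d) → F) :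
    ∫ x, g x ∂stdGauss d =
      ∫ x, ((2 * π) ^ (-(d : ℝ) / 2) * Real.exp (-‖x‖ ^ 2 / 2)) • g x := by
  rw [stdGauss, integral_withDensity_eq_integral_toReal_smul (by fun_prop)
    (Filter.Eventually.of_forall fun _ => ENNReal.ofReal_lt_top)]
  refine integral_congr_ae (Filter.Eventually.of_forall fun x => ?_)
  simp only
  rw [ENNReal.toReal_ofReal (by positivity)]

theorem isFiniteMeasure_stdGauss (d : ℕ) : IsFiniteMeasure (stdGauss d) := by
  refine isFiniteMeasure_withDensity_ofReal (Integrable.hasFiniteIntegral ?_)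
  have h := GaussianFourier.integrable_cexp_neg_mul_sq_norm_add (b := 1 / 2)
    (by norm_num) 0 (0 : EuclideanSpace ℝ (Fin d))
  refine Integrable.const_mul (h.norm.congr (Filter.Eventually.of_forall fun x => ?_)) _
  simp only [Complex.norm_exp]
  congr 1
  simp [← Complex.ofReal_pow]
  ring

theorem stdGauss_eq_stdGaussian (d : ℕ) :
    stdGauss d = stdGaussian (EuclideanSpace ℝ (Fin d)) := by
  have := isFiniteMeasure_stdGauss d
  refine Measure.ext_of_charFun ?_
  ext t
  rw [charFun_stdGaussian, charFun_apply, integral_stdGauss]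
  have h := GaussianFourier.integral_cexp_neg_mul_sq_norm_add (b := 1 / 2)
    (by norm_num) Complex.I t
  have h2 : ∀ x : EuclideanSpace ℝ (Fin d),
      ((2 * π) ^ (-(d : ℝ) / 2) * Real.exp (-‖x‖ ^ 2 / 2)) • Complex.exp (⟪x, t⟫ * Complex.I) =
      (((2 * π) ^ (-(d : ℝ) / 2) : ℝ) : ℂ) *
        Complex.exp (-(1 / 2) * ‖x‖ ^ 2 + Complex.I * ⟪t, x⟫) := by
    intro x
    rw [Complex.exp_add, real_inner_comm, Complex.real_smul]
    push_cast
    rw [mul_assoc, mul_comm (Complex.I)]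
    congr 3
    ring
  simp_rw [h2]
  rw [integral_const_mul, h, ← mul_assoc]
  have h3 : (((2 * π) ^ (-(d : ℝ) / 2) : ℝ) : ℂ) *
      (π / (1 / 2) : ℂ) ^ (Module.finrank ℝ (EuclideanSpace ℝ (Fin d)) / 2 : ℂ) = 1 := by
    have : (π / (1 / 2) : ℂ) = ((2 * π : ℝ) : ℂ) := by push_cast; ring
    rw [this, finrank_euclideanSpace_fin]
    have h4 : ((d : ℂ) / 2) = (((d : ℝ) / 2 : ℝ) : ℂ) := by push_cast; rfl
    rw [h4, ← Complex.ofReal_cpow (by positivity), ← Complex.ofReal_mul,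
      ← Real.rpow_add (by positivity)]
    simp [neg_div]
  rw [h3, one_mul, Complex.I_sq]
  congr 1
  ring

section Concentration

variable {E : Type*} [NormedAddCommGroup E] [InnerProductSpace ℝ E]

/-- Jensen's inequality along the quarter circle from `x` to `y`. -/
theorem exp_sub_le_lintegral_quarterCircle {f : E → ℝ} (hf : ContDiff ℝ 1 f) (x y : E) :
    ENNReal.ofReal (exp (f y - f x)) ≤
      ∫⁻ s in Set.Ioc (0 : ℝ) 1, ENNReal.ofReal (exp (π / 2 *
        fderiv ℝ f (cos (π / 2 * s) • x + sin (π / 2 * s) • y)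
          (-sin (π / 2 * s) • x + cos (π / 2 * s) • y))) := by
  set φ : ℝ → ℝ := fun s => π / 2 * fderiv ℝ f (cos (π / 2 * s) • x + sin (π / 2 * s) • y)
          (-sin (π / 2 * s) • x + cos (π / 2 * s) • y) with hφ
  have hcont : Continuous φ := by
    have h := hf.continuous_fderiv one_ne_zero
    fun_prop
  have hderiv : ∀ s : ℝ,
      HasDerivAt (fun s => f (cos (π / 2 * s) • x + sin (π / 2 * s) • y)) (φ s) s := by
    intro s
    have hid : HasDerivAt (fun s : ℝ => π / 2 * s) (π / 2) s := by
      simpa using (hasDerivAt_id s).const_mul (π / 2)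
    have hγ : HasDerivAt (fun s : ℝ => cos (π / 2 * s) • x + sin (π / 2 * s) • y)
        ((π / 2) • (-sin (π / 2 * s) • x + cos (π / 2 * s) • y)) s := by
      convert! (hid.cos.smul_const x).add (hid.sin.smul_const y) using 1
      module
    have := ((hf.differentiable one_ne_zero).differentiableAt.hasFDerivAt
      (x := cos (π / 2 * s) • x + sin (π / 2 * s) • y)).comp_hasDerivAt s hγ
    rwa [map_smul, smul_eq_mul] at this
  have hftc : ∫ s in Set.Ioc (0 : ℝ) 1, φ s = f y - f x := by
    rw [← intervalIntegral.integral_of_le zero_le_one,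
      intervalIntegral.integral_eq_sub_of_hasDerivAt (fun s _ => hderiv s)
        (hcont.intervalIntegrable _ _)]
    simp
  have : IsProbabilityMeasure (volume.restrict (Set.Ioc (0 : ℝ) 1)) := ⟨by simp⟩
  have hint : ∀ ψ : ℝ → ℝ, Continuous ψ → Integrable ψ (volume.restrict (Set.Ioc (0 : ℝ) 1)) :=
    fun ψ hψ => (hψ.integrableOn_Icc (a := 0) (b := 1)).mono_set Set.Ioc_subset_Icc_self
  have hexp : Integrable (fun s => exp (φ s)) (volume.restrict (Set.Ioc (0 : ℝ) 1)) :=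
    hint _ (continuous_exp.comp hcont)
  rw [← ofReal_integral_eq_lintegral_ofReal hexp
    (Filter.Eventually.of_forall fun s => (exp_pos _).le), ← hftc]
  exact ENNReal.ofReal_le_ofReal (convexOn_exp.map_integral_le continuous_exp.continuousOn
    isClosed_univ (by simp) (hint _ hcont) hexp)

variable [FiniteDimensional ℝ E] [MeasurableSpace E] [BorelSpace E]

theorem lintegral_exp_strongDual_stdGaussian (L : StrongDual ℝ E) :
    ∫⁻ v, ENNReal.ofReal (exp (L v)) ∂stdGaussian E = ENNReal.ofReal (exp (‖L‖ ^ 2 / 2)) := by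
  have hmap := IsGaussian.map_eq_gaussianReal (μ := stdGaussian E) L
  have hm : AEMeasurable L (stdGaussian E) := by fun_prop
  rw [integral_strongDual_stdGaussian, variance_dual_stdGaussian] at hmap
  have hi : Integrable (fun v => exp (L v)) (stdGaussian E) := by
    have h := integrable_exp_mul_gaussianReal (μ := 0) (v := (‖L‖ ^ 2).toNNReal) 1
    rw [← hmap, integrable_map_measure (by fun_prop) hm] at h
    simpa [Function.comp_def] using h
  rw [← ofReal_integral_eq_lintegral_ofReal hi
    (Filter.Eventually.of_forall fun s => (exp_pos _).le)]
  have := mgf_gaussianReal hmap 1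
  simp only [mgf, one_mul] at this
  rw [this]
  simp

theorem LipschitzWith.memLp_stdGaussian {f : E → ℝ} {K : NNReal} (hf : LipschitzWith K f)
    {p : ENNReal} (hp : p ≠ ⊤) : MemLp f p (stdGaussian E) := by
  have h1 : MemLp (fun x => |f 0| + K * ‖x‖) p (stdGaussian E) :=
    (memLp_const |f 0|).add ((IsGaussian.memLp_id (stdGaussian E) p hp).norm.const_mul (K : ℝ))
  refine h1.mono hf.continuous.aestronglyMeasurable (Filter.Eventually.of_forall fun x => ?_)
  have h := hf.norm_sub_le x 0
  rw [sub_zero] at h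
  have h2 : ‖f x‖ ≤ ‖f 0‖ + ‖f x - f 0‖ := by
    simpa using norm_add_le (f 0) (f x - f 0)
  refine le_trans ?_ (le_abs_self _)
  simp only [Real.norm_eq_abs] at *
  linarith

theorem one_le_lintegral_exp_neg {α : Type*} [MeasurableSpace α] {μ : Measure α}
    [IsProbabilityMeasure μ] {f : α → ℝ} (hf : Integrable f μ) (h0 : ∫ x, f x ∂μ = 0) :
    1 ≤ ∫⁻ x, ENNReal.ofReal (exp (-f x)) ∂μ := by
  have hi : Integrable (fun x => 1 - f x) μ := (integrable_const _).sub hf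
  calc (1 : ENNReal) = ENNReal.ofReal (∫ x, (1 - f x) ∂μ) := by
        rw [integral_sub (integrable_const _) hf, h0]; simp
    _ ≤ ENNReal.ofReal (∫ x, max (1 - f x) 0 ∂μ) :=
        ENNReal.ofReal_le_ofReal (integral_mono hi hi.pos_part fun x => le_max_left _ _)
    _ = ∫⁻ x, ENNReal.ofReal (max (1 - f x) 0) ∂μ :=
        ofReal_integral_eq_lintegral_ofReal hi.pos_part
          (Filter.Eventually.of_forall fun x => le_max_right _ _)
    _ ≤ _ := lintegral_mono fun x => ENNReal.ofReal_le_ofReal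
        (max_le (by linarith [add_one_le_exp (-f x)]) (exp_pos _).le)

/-- Maurey–Pisier form of Gaussian concentration. -/
theorem lintegral_exp_le_of_lipschitz {f : E → ℝ} (hf : ContDiff ℝ 1 f) {K : NNReal}
    (hK : LipschitzWith K f) (h0 : ∫ x, f x ∂stdGaussian E = 0) :
    ∫⁻ x, ENNReal.ofReal (exp (f x)) ∂stdGaussian E ≤
      ENNReal.ofReal (exp (π ^ 2 / 8 * K ^ 2)) := by
  set μ := stdGaussian E
  have hfc : Continuous f := hf.continuous
  have hfd := hf.continuous_fderiv one_ne_zero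
  set ρ : Measure ℝ := volume.restrict (Set.Ioc (0 : ℝ) 1)
  set G : E × E → ENNReal := fun q => ENNReal.ofReal (exp (π / 2 * fderiv ℝ f q.1 q.2)) with hG
  have hGc : Continuous G := ENNReal.continuous_ofReal.comp (by fun_prop)
  have hrot : ∀ θ : ℝ, ∫⁻ q, G (ContinuousLinearMap.rotation θ q) ∂μ.prod μ =
      ∫⁻ q, G q ∂μ.prod μ := by
    intro θ
    rw [← lintegral_map hGc.measurable (ContinuousLinearMap.continuous _).measurable,
      IsGaussian.map_rotation_eq_self (by simp [μ])]
  have hG' : ∫⁻ q, G q ∂μ.prod μ ≤ ENNReal.ofReal (exp (π ^ 2 / 8 * K ^ 2)) := by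
    rw [lintegral_prod _ hGc.measurable.aemeasurable]
    calc ∫⁻ u, ∫⁻ v, G (u, v) ∂μ ∂μ ≤ ∫⁻ _, ENNReal.ofReal (exp (π ^ 2 / 8 * K ^ 2)) ∂μ := by
          refine lintegral_mono fun u => ?_
          have h := lintegral_exp_strongDual_stdGaussian ((π / 2) • fderiv ℝ f u)
          simp only [smul_apply, smul_eq_mul] at h
          simp only [hG]
          rw [h, norm_smul, Real.norm_of_nonneg (by positivity)]
          have := norm_fderiv_le_of_lipschitz ℝ hK (x₀ := u)
          refine ENNReal.ofReal_le_ofReal (exp_le_exp.2 ?_)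
          have h2 : ‖fderiv ℝ f u‖ ^ 2 ≤ (K : ℝ) ^ 2 := by gcongr
          nlinarith [sq_nonneg π]
      _ = _ := by simp
  have hprod : ∫⁻ q, ENNReal.ofReal (exp (f q.2 - f q.1)) ∂μ.prod μ ≤ ∫⁻ q, G q ∂μ.prod μ := by
    calc ∫⁻ q, ENNReal.ofReal (exp (f q.2 - f q.1)) ∂μ.prod μ
        ≤ ∫⁻ q, ∫⁻ s, G (ContinuousLinearMap.rotation (π / 2 * s) q) ∂ρ ∂μ.prod μ :=
          lintegral_mono fun q => exp_sub_le_lintegral_quarterCircle hf q.1 q.2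
      _ = ∫⁻ s, ∫⁻ q, G (ContinuousLinearMap.rotation (π / 2 * s) q) ∂μ.prod μ ∂ρ := by
          refine lintegral_lintegral_swap (Continuous.measurable ?_).aemeasurable
          simp only [Function.uncurry_def, ContinuousLinearMap.rotation_apply]
          exact hGc.comp (by fun_prop)
      _ = _ := by simp [hrot, ρ]
  have hsplit : ∫⁻ q, ENNReal.ofReal (exp (f q.2 - f q.1)) ∂μ.prod μ =
      (∫⁻ x, ENNReal.ofReal (exp (-f x)) ∂μ) * ∫⁻ y, ENNReal.ofReal (exp (f y)) ∂μ := by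
    rw [← lintegral_prod_mul (by fun_prop) (by fun_prop)]
    refine lintegral_congr fun q => ?_
    rw [← ENNReal.ofReal_mul (exp_pos _).le, ← exp_add]
    ring_nf
  calc _ ≤ (∫⁻ x, ENNReal.ofReal (exp (-f x)) ∂μ) * ∫⁻ y, ENNReal.ofReal (exp (f y)) ∂μ :=
        le_mul_of_one_le_left' (one_le_lintegral_exp_neg
          ((hK.memLp_stdGaussian ENNReal.one_ne_top).integrable le_rfl) h0)
    _ ≤ _ := hsplit ▸ hprod.trans hG'

theorem integrable_and_integral_exp_mul_le {f : E → ℝ} (hf : ContDiff ℝ 1 f) {K : NNReal}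
    (hK : LipschitzWith K f) (h0 : ∫ x, f x ∂stdGaussian E = 0) (t : ℝ) :
    Integrable (fun x => exp (t * f x)) (stdGaussian E) ∧
      ∫ x, exp (t * f x) ∂stdGaussian E ≤ exp (π ^ 2 / 8 * (|t| * K) ^ 2) := by
  have hlip : LipschitzWith (‖t‖₊ * K) (fun x => t * f x) := by
    exact (lipschitzWith_smul t).comp hK
  have hl := lintegral_exp_le_of_lipschitz (contDiff_const.mul hf) hlip
    (by rw [integral_const_mul, h0, mul_zero])
  have hc := hf.continuous
  have hm : AEStronglyMeasurable (fun x => exp (t * f x)) (stdGaussian E) := by fun_prop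
  have hnn : 0 ≤ᵐ[stdGaussian E] fun x => exp (t * f x) :=
    Filter.Eventually.of_forall fun x => (exp_pos _).le
  refine ⟨⟨hm, (hasFiniteIntegral_iff_ofReal hnn).2 (hl.trans_lt ENNReal.ofReal_lt_top)⟩, ?_⟩
  rw [integral_eq_lintegral_of_nonneg_ae hnn hm]
  exact ENNReal.toReal_le_of_le_ofReal (exp_pos _).le (by simpa using hl)

end Concentration

section SemiconcaveBound

variable {E : Type*} [NormedAddCommGroup E]

/-- A function with second differences at most `M‖h‖²` lies below its tangent paraboloids. -/
theorem le_add_fderiv_add_sq_of_second_difference_le [NormedSpace ℝ E] {f : E → ℝ} {M : ℝ}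
    (hM : ∀ x h : E, f (x + h) + f (x - h) - 2 * f x ≤ M * ‖h‖ ^ 2) {x : E}
    (hf : DifferentiableAt ℝ f x) (h : E) :
    f (x + h) ≤ f x + fderiv ℝ f x h + M / 2 * ‖h‖ ^ 2 := by
  set R : E → ℝ := fun v => f (x + v) - f x - fderiv ℝ f x v - M / 2 * ‖v‖ ^ 2 with hR
  have hhalf : ∀ v, R v ≤ 2 * R ((1 / 2 : ℝ) • v) := by
    intro v
    have h1 := hM (x + (1 / 2 : ℝ) • v) ((1 / 2 : ℝ) • v)
    rw [show x + (1 / 2 : ℝ) • v + (1 / 2 : ℝ) • v = x + v by module,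
      show x + (1 / 2 : ℝ) • v - (1 / 2 : ℝ) • v = x by module] at h1
    simp only [hR, map_smul, smul_eq_mul, norm_smul, Real.norm_eq_abs] at h1 ⊢
    rw [abs_of_pos (by norm_num)] at h1 ⊢
    nlinarith
  have hiter : ∀ n : ℕ, R h ≤ 2 ^ n * R ((1 / 2 : ℝ) ^ n • h) := by
    intro n
    induction n with
    | zero => simp
    | succ n ih =>
      have h1 := hhalf ((1 / 2 : ℝ) ^ n • h)
      rw [smul_smul, ← pow_succ'] at h1
      calc R h ≤ 2 ^ n * R ((1 / 2 : ℝ) ^ n • h) := ih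
        _ ≤ 2 ^ n * (2 * R ((1 / 2 : ℝ) ^ (n + 1) • h)) := by gcongr
        _ = _ := by ring
  have hlim : Filter.Tendsto (fun n : ℕ => 2 ^ n * R ((1 / 2 : ℝ) ^ n • h)) Filter.atTop
      (nhds 0) := by
    have hhalf0 : Filter.Tendsto (fun n : ℕ => (1 / 2 : ℝ) ^ n) Filter.atTop (nhds 0) :=
      tendsto_pow_atTop_nhds_zero_of_lt_one (by norm_num) (by norm_num)
    have h1 := hf.hasFDerivAt.lim_real h
    have h2 : Filter.Tendsto (fun n : ℕ => (2 : ℝ) ^ n) Filter.atTop Filter.atTop :=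
      tendsto_pow_atTop_atTop_of_one_lt (by norm_num)
    have h3 := ((h1.comp h2).sub_const (fderiv ℝ f x h)).sub (hhalf0.const_mul (M / 2 * ‖h‖ ^ 2))
    simp only [sub_self, mul_zero] at h3
    refine h3.congr fun n => ?_
    have h4 : ((2 : ℝ) ^ n)⁻¹ = (1 / 2) ^ n := by simp
    have h5 : (2 : ℝ) ^ n * (1 / 2) ^ n = 1 := by rw [← mul_pow]; norm_num
    simp only [Function.comp_apply, hR, smul_eq_mul, h4, map_smul, norm_smul, norm_pow,
      Real.norm_eq_abs]
    rw [abs_of_pos (by norm_num : (0 : ℝ) < 1 / 2)]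
    linear_combination (M / 2 * ‖h‖ ^ 2 * (1 / 2) ^ n + fderiv ℝ f x h) * h5
  have := ge_of_tendsto hlim (Filter.Eventually.of_forall hiter)
  simp only [hR] at this
  linarith

theorem Hconv_le {f : E → ℝ} {K : NNReal} (hf : LipschitzWith K f) (x y : E) :
    Hconv f x ≤ f (x + y) + ‖y‖ ^ 2 / 2 := by
  refine ciInf_le ⟨f x - (K : ℝ) ^ 2 / 2, ?_⟩ y
  rintro _ ⟨z, rfl⟩
  have h := hf.norm_sub_le (x + z) x
  rw [add_sub_cancel_left] at h
  have := (abs_le.1 h).1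
  simp only
  nlinarith [sq_nonneg ((K : ℝ) - ‖z‖)]

theorem Hconv_le_of_second_difference_le [InnerProductSpace ℝ E] [CompleteSpace E] {f : E → ℝ}
    {K : NNReal} (hf : LipschitzWith K f) {M : ℝ}
    (hM : ∀ x h : E, f (x + h) + f (x - h) - 2 * f x ≤ M * ‖h‖ ^ 2) {x : E}
    (hd : DifferentiableAt ℝ f x) :
    Hconv f x ≤ f x - ‖gradient f x‖ ^ 2 / 2 + M / 2 * ‖gradient f x‖ ^ 2 := by
  have h1 := Hconv_le hf x (-gradient f x)
  have h2 := le_add_fderiv_add_sq_of_second_difference_le hM hd (-gradient f x)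
  rw [hd.hasGradientAt.fderiv_apply, inner_neg_right, real_inner_self_eq_norm_sq] at h2
  rw [norm_neg] at h1 h2
  linarith

end SemiconcaveBound

theorem exp_le_taylor_two_add (x : ℝ) :
    exp x ≤ 1 + x + x ^ 2 / 2 + |x| ^ 3 * exp |x| := by
  have h := Complex.norm_exp_sub_sum_le_norm_mul_exp (x : ℂ) 3
  have h2 : Complex.exp (x : ℂ) - ∑ m ∈ Finset.range 3, (x : ℂ) ^ m / (m.factorial : ℂ) =
      ((exp x - (1 + x + x ^ 2 / 2) : ℝ) : ℂ) := by
    simp [Finset.sum_range_succ, Nat.factorial]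
  rw [h2, Complex.norm_real, Complex.norm_real, Real.norm_eq_abs, Real.norm_eq_abs] at h
  linarith [le_abs_self (exp x - (1 + x + x ^ 2 / 2))]

theorem cube_mul_exp_le {w : ℝ} (hw : 0 ≤ w) : w ^ 3 * exp w ≤ 6 * exp (2 * w) := by
  have h := Real.pow_div_factorial_le_exp w hw 3
  rw [show 2 * w = w + w by ring, exp_add]
  norm_num [Nat.factorial] at h
  nlinarith [exp_pos w]

/-- Second-order expansion of `exp (a + b)` for `a` of order `ε` and `b` of order `ε²`. -/
theorem exp_add_le_expansion {a b B ε : ℝ} (hε : 0 < ε) (hε1 : ε ≤ 1) (hb : |b| ≤ B * ε ^ 2) :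
    exp (a + b) ≤ 1 + a + b + a ^ 2 / 2 +
      ε ^ 3 * (B ^ 2 / 2 + (B + 6 * exp (2 * B)) * (exp (2 / ε * a) + exp (-(2 / ε) * a))) := by
  have hB : 0 ≤ B := nonneg_of_mul_nonneg_left ((abs_nonneg b).trans hb) (by positivity)
  set u := |a| / ε with hu
  have hau : |a| = ε * u := by rw [hu]; field_simp
  have hu0 : 0 ≤ u := by positivity
  have hS : exp (2 * u) ≤ exp (2 / ε * a) + exp (-(2 / ε) * a) := by
    rcases abs_choice a with h | h
    · rw [hu, h, show 2 * (a / ε) = 2 / ε * a by ring]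
      linarith [exp_pos (-(2 / ε) * a)]
    · rw [hu, h, show 2 * (-a / ε) = -(2 / ε) * a by ring]
      linarith [exp_pos ((2 / ε) * a)]
  have hb1 : |b| ≤ B * ε := hb.trans (by nlinarith [mul_nonneg hB hε.le])
  have hab : |a + b| ≤ ε * (u + B) := (abs_add_le a b).trans (by rw [hau]; linarith)
  have hab1 : |a + b| ≤ u + B := hab.trans (by nlinarith)
  have hcube : |a + b| ^ 3 * exp |a + b| ≤ ε ^ 3 * (6 * exp (2 * B) * exp (2 * u)) := by
    calc |a + b| ^ 3 * exp |a + b| ≤ (ε * (u + B)) ^ 3 * exp (u + B) := by gcongr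
      _ = ε ^ 3 * ((u + B) ^ 3 * exp (u + B)) := by ring
      _ ≤ ε ^ 3 * (6 * exp (2 * (u + B))) := by
        have := cube_mul_exp_le (add_nonneg hu0 hB)
        gcongr
      _ = _ := by rw [mul_add, exp_add]; ring
  have hcross : a * b ≤ ε ^ 3 * (B * exp (2 * u)) := by
    calc a * b ≤ |a| * |b| := by rw [← abs_mul]; exact le_abs_self _
      _ ≤ (ε * u) * (B * ε ^ 2) := by rw [hau]; gcongr
      _ = ε ^ 3 * (B * u) := by ring
      _ ≤ _ := by
        gcongr
        linarith [add_one_le_exp (2 * u)]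
  have hsq : b ^ 2 ≤ ε ^ 3 * B ^ 2 := by
    calc b ^ 2 = |b| ^ 2 := (sq_abs b).symm
      _ ≤ (B * ε ^ 2) ^ 2 := by gcongr
      _ = ε ^ 4 * B ^ 2 := by ring
      _ ≤ _ := by
        gcongr ?_ * _
        exact pow_le_pow_of_le_one hε.le hε1 (by norm_num)
  have hfin : ε ^ 3 * ((B + 6 * exp (2 * B)) * exp (2 * u)) ≤
      ε ^ 3 * ((B + 6 * exp (2 * B)) * (exp (2 / ε * a) + exp (-(2 / ε) * a))) := by gcongr
  linarith [exp_le_taylor_two_add (a + b), add_sq a b, mul_add (ε ^ 3) (B ^ 2 / 2)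
    ((B + 6 * exp (2 * B)) * (exp (2 / ε * a) + exp (-(2 / ε) * a)))]

/-- Upper bound for `E[e^{Hf(X)}]`: for every `C > 0` there is a constant `K₆`
depending only on `C` such that for every `ε ∈ (0,1]` and every mean-zero `C²`
function `f ∈ F(C,ε)`,
`E[e^{Hf(X)}] ≤ 1 + ½E[f(X)²] − ½E[|∇f(X)|²] + K₆ε³`. -/
theorem exp_H_moment_bound (C : ℝ) (hC : 0 < C) :
    ∃ K₆ : ℝ, ∀ (d : ℕ) (ε : ℝ), ε ∈ Set.Ioc (0 : ℝ) 1 →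
      ∀ f : EuclideanSpace ℝ (Fin d) → ℝ, ContDiff ℝ 2 f → memF C ε f →
        (∫ x, f x ∂stdGauss d) = 0 →
        ∫ x, Real.exp (Hconv f x) ∂stdGauss d ≤
          1 + (∫ x, f x ^ 2 ∂stdGauss d) / 2 -
            (∫ x, ‖gradient f x‖ ^ 2 ∂stdGauss d) / 2 + K₆ * ε ^ 3 := by
  set B : ℝ := C ^ 2 / 2 + C ^ 3 / 2 with hB
  set D : ℝ := 6 * exp (2 * B) + B
  refine ⟨C ^ 3 / 2 + B ^ 2 / 2 + D * (2 * exp (π ^ 2 / 8 * (2 * C) ^ 2)), ?_⟩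
  rintro d ε ⟨hε, hε1⟩ f hf ⟨hlip, hsemi⟩ h0
  rw [stdGauss_eq_stdGaussian] at *
  set μ := stdGaussian (EuclideanSpace ℝ (Fin d))
  have hf1 : ContDiff ℝ 1 f := hf.of_le (by norm_num)
  have hdiff : Differentiable ℝ f := hf1.differentiable one_ne_zero
  have hCε : ((C * ε).toNNReal : ℝ) = C * ε := Real.coe_toNNReal _ (by positivity)
  have hgrad : ∀ x, ‖gradient f x‖ ≤ C * ε := fun x => by
    rw [gradient, LinearIsometryEquiv.norm_map, ← hCε]
    exact norm_fderiv_le_of_lipschitz ℝ hlip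
  have hgradsq : ∀ x, ‖gradient f x‖ ^ 2 ≤ C ^ 2 * ε ^ 2 := fun x => by
    rw [← mul_pow]
    exact pow_le_pow_left₀ (norm_nonneg _) (hgrad x) 2
  have hexp : ∀ t : ℝ, |t| = 2 / ε → Integrable (fun x => exp (t * f x)) μ ∧
      ∫ x, exp (t * f x) ∂μ ≤ exp (π ^ 2 / 8 * (2 * C) ^ 2) := by
    intro t ht
    have h := integrable_and_integral_exp_mul_le hf1 hlip h0 t
    rwa [ht, hCε, show 2 / ε * (C * ε) = 2 * C by field_simp] at h
  obtain ⟨hi1, hb1⟩ := hexp (2 / ε) (abs_of_pos (by positivity))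
  obtain ⟨hi2, hb2⟩ := hexp (-(2 / ε)) (by rw [abs_neg, abs_of_pos (by positivity)])
  have hif : Integrable f μ := (hlip.memLp_stdGaussian ENNReal.one_ne_top).integrable le_rfl
  have hif2 : Integrable (fun x => f x ^ 2) μ :=
    (hlip.memLp_stdGaussian ENNReal.ofNat_ne_top).integrable_sq
  have hgc : Continuous (gradient f) :=
    (InnerProductSpace.toDual ℝ _).symm.continuous.comp (hf1.continuous_fderiv one_ne_zero)
  have hig : Integrable (fun x => ‖gradient f x‖ ^ 2) μ := by
    refine Integrable.of_bound (by fun_prop) (C ^ 2 * ε ^ 2)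
      (Filter.Eventually.of_forall fun x => ?_)
    rw [Real.norm_of_nonneg (by positivity)]
    exact hgradsq x
  have hpoint : ∀ x, exp (Hconv f x) ≤
      (1 + ε ^ 3 * (C ^ 3 / 2 + B ^ 2 / 2)) + f x - ‖gradient f x‖ ^ 2 / 2 + f x ^ 2 / 2 +
        ε ^ 3 * D * (exp (2 / ε * f x) + exp (-(2 / ε) * f x)) := by
    intro x
    have hH := Hconv_le_of_second_difference_le hlip hsemi (hdiff x)
    set b : ℝ := -(‖gradient f x‖ ^ 2 / 2) + C * ε ^ 2 / 2 * ‖gradient f x‖ ^ 2 with hbdef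
    have hg0 : 0 ≤ ‖gradient f x‖ ^ 2 := by positivity
    have h4 : C * ε ^ 2 / 2 * ‖gradient f x‖ ^ 2 ≤ C ^ 3 / 2 * ε ^ 4 := by
      calc _ ≤ C * ε ^ 2 / 2 * (C ^ 2 * ε ^ 2) := by gcongr; exact hgradsq x
        _ = _ := by ring
    have h40 : 0 ≤ C * ε ^ 2 / 2 * ‖gradient f x‖ ^ 2 := by positivity
    have h43 : C ^ 3 / 2 * ε ^ 4 ≤ C ^ 3 / 2 * ε ^ 3 := by
      gcongr C ^ 3 / 2 * ?_
      exact pow_le_pow_of_le_one hε.le hε1 (by norm_num)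
    have h42 : C ^ 3 / 2 * ε ^ 4 ≤ C ^ 3 / 2 * ε ^ 2 := by
      gcongr C ^ 3 / 2 * ?_
      exact pow_le_pow_of_le_one hε.le hε1 (by norm_num)
    have hC3 : 0 ≤ C ^ 3 / 2 * ε ^ 2 := by positivity
    have hC2 : 0 ≤ C ^ 2 * ε ^ 2 := by positivity
    have hb : |b| ≤ B * ε ^ 2 := by
      rw [abs_le, hB, add_mul]
      constructor <;> linarith [hgradsq x]
    have hmain := exp_add_le_expansion (a := f x) hε hε1 hb
    have hle : exp (Hconv f x) ≤ exp (f x + b) := exp_le_exp.2 (by linarith)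
    rw [mul_add (ε ^ 3), ← mul_assoc (ε ^ 3) (B + 6 * exp (2 * B)), add_comm B] at hmain
    linarith
  have hisum := (hi1.add hi2).const_mul (ε ^ 3 * D)
  have hia := (integrable_const (μ := μ) (1 + ε ^ 3 * (C ^ 3 / 2 + B ^ 2 / 2))).add hif
  have hib := hia.sub (hig.div_const 2)
  have hic := hib.add (hif2.div_const 2)
  have hD0 : 0 ≤ ε ^ 3 * D := by positivity
  calc ∫ x, exp (Hconv f x) ∂μ
      ≤ ∫ x, ((1 + ε ^ 3 * (C ^ 3 / 2 + B ^ 2 / 2)) + f x - ‖gradient f x‖ ^ 2 / 2 + f x ^ 2 / 2 +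
        ε ^ 3 * D * (exp (2 / ε * f x) + exp (-(2 / ε) * f x))) ∂μ :=
        integral_mono_of_nonneg (Filter.Eventually.of_forall fun x => (exp_pos _).le)
          (hic.add hisum) (Filter.Eventually.of_forall hpoint)
    _ = (1 + ε ^ 3 * (C ^ 3 / 2 + B ^ 2 / 2)) - (∫ x, ‖gradient f x‖ ^ 2 ∂μ) / 2 +
        (∫ x, f x ^ 2 ∂μ) / 2 + ε ^ 3 * D *
          (∫ x, exp (2 / ε * f x) ∂μ + ∫ x, exp (-(2 / ε) * f x) ∂μ) := by
        refine (integral_add' hic hisum).trans ?_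
        rw [integral_add' hib (hif2.div_const 2),
          integral_sub' hia (hig.div_const 2), integral_add' (integrable_const _) hif, h0]
        simp only [Pi.add_apply]
        rw [integral_const_mul, integral_add hi1 hi2, integral_div, integral_div]
        simp
    _ ≤ (1 + ε ^ 3 * (C ^ 3 / 2 + B ^ 2 / 2)) - (∫ x, ‖gradient f x‖ ^ 2 ∂μ) / 2 +
        (∫ x, f x ^ 2 ∂μ) / 2 + ε ^ 3 * D * (exp (π ^ 2 / 8 * (2 * C) ^ 2) +
          exp (π ^ 2 / 8 * (2 * C) ^ 2)) := by gcongr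
    _ = _ := by ring
end
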